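/- arXiv:0706.2010 — 3 statements merged into one kernel-verified Lean document; each statement's English description precedes it below -/
import Mathlib

section
/- Privacy of the parity (dining cryptographers) protocol: let H ⊆ Fin n be the set of honest participants and let x, x' : H → ZMod 2 be two input assignments with equal total parity, ∑_{i ∈ H} x i = ∑_{i ∈ H} x' i. For an input assignment y, let μ_y be the uniform probability distribution on the finite set of matrices R : H → Fin n → ZMod 2 satisfying ∑_j R i j = y i for every i ∈ H. Let the view map V send R to the pair consisting of (a) all entries R i j with i ∈ H and j ∉ H (the shares sent to corrupt participants) and (b) the function j ↦ ∑_{i ∈ H} R i j on Fin n (the honest contributions to each column sum). Then the pushforward of μ_x under V equals the pushforward of μ_{x'} under V; that is, the adversary's view depends on the honest inputs only through their total parity. -/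
open Finset

/-- The finite set of share matrices `R : H → Fin n → ZMod 2` whose rows sum to
the honest inputs `y`. -/
noncomputable def parityMatrices (n : ℕ) (H : Finset (Fin n)) (y : H → ZMod 2) :
    Finset (H → Fin n → ZMod 2) :=
  Finset.univ.filter (fun R => ∀ i : H, ∑ j, R i j = y i)

theorem parityMatrices_nonempty (n : ℕ) (H : Finset (Fin n)) (y : H → ZMod 2) :
    (parityMatrices n H y).Nonempty := by
  refine ⟨fun i j => if j = (i : Fin n) then y i else 0, ?_⟩
  simp [parityMatrices, Finset.sum_ite_eq']

/-- The uniform distribution on share matrices consistent with honest inputs `y`. -/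
noncomputable def parityUniform (n : ℕ) (H : Finset (Fin n)) (y : H → ZMod 2) :
    PMF (H → Fin n → ZMod 2) :=
  PMF.uniformOfFinset (parityMatrices n H y) (parityMatrices_nonempty n H y)

/-- The adversary's view of a share matrix: the shares sent to corrupt
participants, together with the honest contribution to each column sum. -/
noncomputable def parityView (n : ℕ) (H : Finset (Fin n))
    (R : H → Fin n → ZMod 2) :
    (H → {j : Fin n // j ∉ H} → ZMod 2) × (Fin n → ZMod 2) :=
  (fun i j => R i (j : Fin n), fun j => ∑ i : H, R i j)

/-- **Privacy of the parity (dining cryptographers) protocol.**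
If two honest input assignments `x` and `x'` have the same total parity, then
the distribution of the adversary's view under the uniform distribution on
consistent share matrices is the same for `x` and `x'`. -/
theorem parity_protocol_privacy (n : ℕ) (H : Finset (Fin n))
    (x x' : H → ZMod 2) (hpar : ∑ i : H, x i = ∑ i : H, x' i) :
    (parityUniform n H x).map (parityView n H) =
      (parityUniform n H x').map (parityView n H) := by
  classical
  rcases isEmpty_or_nonempty H with hE | ⟨⟨h0, h0mem⟩⟩
  · rw [Subsingleton.elim x x']
  · let D : H → Fin n → ZMod 2 := fun i j => if j = h0 then x' i - x i else 0
    have hrow : ∀ i, ∑ j, D i j = x' i - x i := by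
      intro i
      simp [D]
    have hcol : ∀ j, ∑ i, D i j = 0 := by
      intro j
      by_cases hj : j = h0
      · simp only [D, hj, if_true, Finset.sum_sub_distrib, hpar, sub_self]
      · simp [D, hj]
    have hmem : ∀ R, R - D ∈ parityMatrices n H x ↔ R ∈ parityMatrices n H x' := by
      intro R
      simp only [parityMatrices, Finset.mem_filter, Finset.mem_univ, true_and, Pi.sub_apply,
        Finset.sum_sub_distrib, hrow]
      refine forall_congr' fun i => ?_
      constructor
      · intro h
        linear_combination h
      · intro h
        linear_combination h
    have hcard : (parityMatrices n H x).card = (parityMatrices n H x').card := by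
      symm
      refine Finset.card_bij (fun R _ => R - D) (fun R hR => (hmem R).2 hR) ?_ ?_
      · intro a _ b _ h
        exact sub_left_injective h
      · intro b hb
        refine ⟨b + D, (hmem _).1 (by simpa using hb), by simp⟩
    have hmap : parityUniform n H x' = (parityUniform n H x).map (fun R => R + D) := by
      ext R
      rw [PMF.map_apply, tsum_eq_single (R - D)]
      · simp only [sub_add_cancel, if_true, parityUniform, PMF.uniformOfFinset_apply, hmem, hcard]
        by_cases hR : R ∈ parityMatrices n H x'
        · simp only [if_pos hR]
        · simp only [if_neg hR]
      · intro b hb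
        rw [if_neg]
        rintro rfl
        simp at hb
    rw [hmap, PMF.map_comp]
    congr 1
    funext R
    simp only [parityView, Function.comp]
    refine Prod.ext ?_ ?_
    · funext i j
      have : (j : Fin n) ≠ h0 := fun h => j.2 (h ▸ h0mem)
      simp [D, this]
    · funext j
      simp only [Pi.add_apply, Finset.sum_add_distrib, hcol, add_zero]
end

section
/- Limiting value of the all-voters flip probability: the sequence n ↦ (1/2)·(1 − (1 − 2/n)^n) (which equals p_n, the probability that the XOR of n independent bits each equal to 1 with probability 1/n is odd) converges, as n → ∞, to 1/2 − 1/(2·e²). -/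
open Filter

/-- **Limiting value of the all-voters flip probability.**
The sequence `n ↦ (1/2)(1 - (1 - 2/n)^n)` converges to `1/2 - 1/(2 e²)`. -/
theorem vote_flip_prob_limit :
    Tendsto (fun n : ℕ => (1 / 2) * (1 - (1 - 2 / (n : ℝ)) ^ n)) atTop
      (nhds (1 / 2 - 1 / (2 * Real.exp 1 ^ 2))) := by
  have h := ((Real.tendsto_one_add_div_pow_exp (-2)).const_sub 1).const_mul (1 / 2)
  have e : (1 / 2 : ℝ) * (1 - Real.exp (-2)) = 1 / 2 - 1 / (2 * Real.exp 1 ^ 2) := by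
    rw [Real.exp_neg, ← Real.exp_nat_mul]
    norm_num
    ring
  rw [e] at h
  refine h.congr fun n => ?_
  rw [neg_div, ← sub_eq_add_neg]
end

section
/- Separation of the vote-protocol flip probabilities and uniqueness of tally decoding: let n ≥ 3 be an integer and define p : ℕ → ℝ by p 0 = 0 and p (v+1) = p v · (1 − 1/n) + (1 − p v) · (1/n). Then for all natural numbers v < w ≤ n one has p w − p v ≥ (1 − 2/n)^{n−1}/n. Consequently, for every real number σ there is at most one v ≤ n satisfying |σ − p v| < (1 − 2/n)^{n−1}/(2n). -/
/-- **Separation of the vote-protocol flip probabilities and uniqueness of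
tally decoding.** If `p 0 = 0` and `p (v+1) = p v (1 - 1/n) + (1 - p v)(1/n)`
with `n ≥ 3`, then for `v < w ≤ n` one has `p w - p v ≥ (1 - 2/n)^(n-1)/n`;
consequently for every real `σ` there is at most one `v ≤ n` with
`|σ - p v| < (1 - 2/n)^(n-1)/(2n)`. -/
theorem vote_flip_prob_separation (n : ℕ) (hn : 3 ≤ n) (p : ℕ → ℝ)
    (h0 : p 0 = 0)
    (hrec : ∀ v, p (v + 1) = p v * (1 - 1 / (n : ℝ)) + (1 - p v) * (1 / (n : ℝ))) :
    (∀ v w : ℕ, v < w → w ≤ n →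
      p w - p v ≥ (1 - 2 / (n : ℝ)) ^ (n - 1) / (n : ℝ)) ∧
    (∀ σ : ℝ, ∀ v w : ℕ, v ≤ n → w ≤ n →
      |σ - p v| < (1 - 2 / (n : ℝ)) ^ (n - 1) / (2 * (n : ℝ)) →
      |σ - p w| < (1 - 2 / (n : ℝ)) ^ (n - 1) / (2 * (n : ℝ)) → v = w) := by
  have hn3 : (3 : ℝ) ≤ (n : ℝ) := by exact_mod_cast hn
  have hpos : (0 : ℝ) < (n : ℝ) := by linarith
  have hr0 : (0 : ℝ) ≤ 1 - 2 / (n : ℝ) := by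
    rw [sub_nonneg, div_le_one hpos]; linarith
  have hr1 : 1 - 2 / (n : ℝ) ≤ 1 := by
    have : (0 : ℝ) ≤ 2 / (n : ℝ) := by positivity
    linarith
  have hstep : ∀ v, p (v + 1) - p v = (1 - 2 / (n : ℝ)) ^ v / (n : ℝ) := by
    intro v
    induction v with
    | zero => rw [hrec, h0]; simp
    | succ k ih =>
      have e : p (k + 1 + 1) - p (k + 1) = (1 - 2 / (n : ℝ)) * (p (k + 1) - p k) := by
        rw [hrec (k + 1)]
        have h := hrec k
        linear_combination -h
      rw [e, ih]; ring
  have hmono : Monotone p := by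
    apply monotone_nat_of_le_succ
    intro v
    have h := hstep v
    have : 0 ≤ (1 - 2 / (n : ℝ)) ^ v / (n : ℝ) := by positivity
    linarith
  have hA : ∀ v w : ℕ, v < w → w ≤ n →
      p w - p v ≥ (1 - 2 / (n : ℝ)) ^ (n - 1) / (n : ℝ) := by
    intro v w hvw hw
    have h1 : p (v + 1) ≤ p w := hmono hvw
    have h2 := hstep v
    have h3 : (1 - 2 / (n : ℝ)) ^ (n - 1) / (n : ℝ) ≤ (1 - 2 / (n : ℝ)) ^ v / (n : ℝ) := by
      apply div_le_div_of_nonneg_right _ hpos.le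
      exact pow_le_pow_of_le_one hr0 hr1 (by omega)
    linarith
  refine ⟨hA, ?_⟩
  intro σ v w hv hw h1 h2
  have e : (1 - 2 / (n : ℝ)) ^ (n - 1) / (2 * (n : ℝ))
      = (1 - 2 / (n : ℝ)) ^ (n - 1) / (n : ℝ) / 2 := by
    rw [div_div, mul_comm]
  rw [e, abs_lt] at h1 h2
  rcases lt_trichotomy v w with h | h | h
  · have := hA v w h hw
    linarith [h1.1, h1.2, h2.1, h2.2]
  · exact h
  · have := hA w v h hv
    linarith [h1.1, h1.2, h2.1, h2.2]
end
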